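/- Assume the standing hypotheses hold (for all n >= N: s_{n,i} in {0,d}, s_{n,r_n} = 0, s_{n,i} not constant over 0 <= i < r_n, where d >= 1). For n >= N write B_{n+1} = (prod_{j=1}^{z_n - 1} B_n^{a_{n,j}} 1^d) B_n^{a_{n,z_n}} with all a_{n,j} >= 1. If a_{n,1} = a_{n,2} = 1, then the word B_n 1^d B_n 1^d B_n is right-special. -/

import Mathlib

/-- The rank-one word sequence: `B 1 = 0` and `B (n+1) = ∏_{i=0}^{r n} B n 1^{s n i}`
over the alphabet `{0,1}` (encoded as `Bool` with `false = 0`, `true = 1`).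
The value at `0` is an irrelevant placeholder. -/
def Bseq (r : ℕ → ℕ) (s : ℕ → ℕ → ℕ) : ℕ → List Bool
  | 0 => [false]
  | 1 => [false]
  | n + 2 =>
      ((List.range (r (n + 1) + 1)).map
        (fun i => Bseq r s (n + 1) ++ List.replicate (s (n + 1) i) true)).flatten

/-- The language of the rank-one subshift: all factors of some `B n`. -/
def InLang (r : ℕ → ℕ) (s : ℕ → ℕ → ℕ) (w : List Bool) : Prop :=
  ∃ n, w <:+: Bseq r s n

/-- A word `w` is right-special if both `w0` and `w1` belong to the language. -/
def RightSpecial (r : ℕ → ℕ) (s : ℕ → ℕ → ℕ) (w : List Bool) : Prop :=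
  InLang r s (w ++ [false]) ∧ InLang r s (w ++ [true])

/-- `w ^ k` : the `k`-fold concatenation of the word `w`. -/
def wpow (w : List Bool) (k : ℕ) : List Bool := (List.replicate k w).flatten

/-- Concatenating a sequence of words over a longer initial range extends the concatenation. -/
theorem flatten_map_range_prefix {α : Type*} (f : ℕ → List α) {k m : ℕ} (h : k ≤ m) :
    ((List.range k).map f).flatten <+: ((List.range m).map f).flatten := by
  induction m, h using Nat.le_induction with
  | base => exact List.prefix_refl _
  | succ m _ ih =>
    refine ih.trans ?_
    simp [List.range_succ]

theorem flatten_map_range_succ {α : Type*} (f : ℕ → List α) (k : ℕ) :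
    ((List.range (k + 1)).map f).flatten = ((List.range k).map f).flatten ++ f k := by
  simp [List.range_succ]

theorem wpow_succ (w : List Bool) (k : ℕ) : wpow w (k + 1) = w ++ wpow w k := by
  simp [wpow, List.replicate_succ]

theorem wpow_succ_right (w : List Bool) (k : ℕ) : wpow w (k + 1) = wpow w k ++ w := by
  simp [wpow, List.replicate_succ']

theorem Bseq_succ (r : ℕ → ℕ) (s : ℕ → ℕ → ℕ) {m : ℕ} (hm : 1 ≤ m) :
    Bseq r s (m + 1) = ((List.range (r m + 1)).map
      (fun i => Bseq r s m ++ List.replicate (s m i) true)).flatten := by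
  obtain ⟨k, rfl⟩ := Nat.exists_eq_add_of_le' hm
  rfl

theorem Bseq_eq_false_cons (r : ℕ → ℕ) (s : ℕ → ℕ → ℕ) (m : ℕ) :
    ∃ t, Bseq r s m = false :: t := by
  induction m with
  | zero => exact ⟨[], rfl⟩
  | succ m ih =>
    rcases Nat.eq_zero_or_pos m with rfl | hm
    · exact ⟨[], rfl⟩
    · obtain ⟨t, ht⟩ := ih
      rw [Bseq_succ r s hm, List.range_succ_eq_map, List.map_cons, List.flatten_cons, ht]
      exact ⟨_, rfl⟩

/-- Two consecutive copies of `B m`, separated by their spacer, occur in `B (m + 1)`. -/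
theorem Bseq_spacer_infix (r : ℕ → ℕ) (s : ℕ → ℕ → ℕ) {m i : ℕ} (hm : 1 ≤ m) (hi : i < r m) :
    Bseq r s m ++ List.replicate (s m i) true ++ Bseq r s m <:+: Bseq r s (m + 1) := by
  rw [Bseq_succ r s hm]
  refine List.IsInfix.trans ?_
    (flatten_map_range_prefix _ (show i + 1 + 1 ≤ r m + 1 by omega)).isInfix
  rw [flatten_map_range_succ, flatten_map_range_succ]
  exact ⟨((List.range i).map (fun i => Bseq r s m ++ List.replicate (s m i) true)).flatten,
    List.replicate (s m (i + 1)) true, by simp only [List.append_assoc]⟩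

/-- Under the standing spacer hypotheses, writing
`B_{n+1} = (∏_{j=1}^{z_n-1} B_n^{a_{n,j}} 1^d) B_n^{a_{n,z_n}}` with all `a_{n,j} ≥ 1`,
if `a_{n,1} = a_{n,2} = 1` then `B_n 1^d B_n 1^d B_n` is right-special. -/
theorem stmt9 (r : ℕ → ℕ) (s : ℕ → ℕ → ℕ) (hr : ∀ n, 1 ≤ r n)
    (d : ℕ) (hd : 1 ≤ d) (N : ℕ) (hN : 1 ≤ N)
    (hyp : ∀ n, N ≤ n →
      (∀ i, i < r n → s n i = 0 ∨ s n i = d) ∧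
      s n (r n) = 0 ∧
      (∃ i, i < r n ∧ s n i = 0) ∧ (∃ i, i < r n ∧ s n i = d))
    (n : ℕ) (hn : N ≤ n) (z : ℕ) (hz : 2 ≤ z) (a : ℕ → ℕ)
    (ha : ∀ j, 1 ≤ j → j ≤ z → 1 ≤ a j)
    (ha2 : ∃ j, 1 ≤ j ∧ j ≤ z ∧ 2 ≤ a j)
    (hrep : Bseq r s (n + 1) =
      ((List.range (z - 1)).map
        (fun j => wpow (Bseq r s n) (a (j + 1)) ++ List.replicate d true)).flatten ++
        wpow (Bseq r s n) (a z))
    (h1 : a 1 = 1) (h2 : a 2 = 1) :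
    RightSpecial r s
      (Bseq r s n ++ List.replicate d true ++ Bseq r s n ++ List.replicate d true ++
        Bseq r s n) := by
  have hz3 : 3 ≤ z := by
    obtain ⟨j, hj1, hjz, hj⟩ := ha2
    by_contra hlt
    obtain rfl | rfl : j = 1 ∨ j = 2 := by omega
    all_goals omega
  set B := Bseq r s n
  set f : ℕ → List Bool := fun j => wpow B (a (j + 1)) ++ List.replicate d true with hf
  have hf1 : ∀ j, a (j + 1) = 1 → f j = B ++ List.replicate d true := by
    intro j hj
    simp [hf, hj, wpow]
  obtain ⟨e, rfl⟩ := Nat.exists_eq_add_of_le' hd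
  constructor
  · classical
    obtain ⟨hj1, hjz, hj⟩ := Nat.find_spec ha2
    have hmin : ∀ i, 1 ≤ i → i < Nat.find ha2 → a i = 1 := by
      intro i hi hlt
      have h := Nat.find_min ha2 hlt
      have := ha i hi (by omega)
      by_contra hne
      exact h ⟨hi, by omega, by omega⟩
    generalize Nat.find ha2 = j at hj1 hjz hj hmin
    have hj3 : 3 ≤ j := by
      by_contra hlt
      obtain rfl | rfl : j = 1 ∨ j = 2 := by omega
      all_goals omega
    obtain ⟨k, rfl⟩ := Nat.exists_eq_add_of_le' hj3
    have hpre : ((List.range (k + 2)).map f).flatten ++ wpow B (a (k + 3)) <+: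
        Bseq r s (n + 1) := by
      rw [hrep]
      rcases hjz.eq_or_lt with rfl | hlt
      · exact List.prefix_refl _
      · refine List.IsPrefix.trans ?_ ((flatten_map_range_prefix f
          (show k + 2 + 1 ≤ z - 1 by omega)).trans (List.prefix_append _ _))
        rw [flatten_map_range_succ f (k + 2)]
        exact ⟨List.replicate (e + 1) true, by simp only [hf, List.append_assoc]⟩
    refine ⟨n + 1, List.IsInfix.trans ?_ hpre.isInfix⟩
    obtain ⟨c, hc⟩ := Nat.exists_eq_add_of_le' hj
    obtain ⟨t, ht⟩ := Bseq_eq_false_cons r s n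
    rw [flatten_map_range_succ, flatten_map_range_succ, hf1 k (hmin _ (by omega) (by omega)),
      hf1 (k + 1) (hmin _ (by omega) (by omega)), hc, wpow_succ, wpow_succ]
    refine ⟨((List.range k).map f).flatten, t ++ wpow B c, ?_⟩
    have hBt : B = [false] ++ t := ht
    calc _ = ((List.range k).map f).flatten ++ (B ++ List.replicate (e + 1) true) ++
          (B ++ List.replicate (e + 1) true) ++ (B ++ (([false] ++ t) ++ wpow B c)) := by
          simp only [List.append_assoc]
      _ = _ := by rw [← hBt]
  · obtain ⟨-, -, -, i, hi, hsi⟩ := hyp (n + 1) (by omega)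
    have hinf := Bseq_spacer_infix r s (show 1 ≤ n + 1 by omega) hi
    rw [hsi] at hinf
    refine ⟨n + 1 + 1, List.IsInfix.trans ?_ hinf⟩
    obtain ⟨p, hp⟩ : B <:+ Bseq r s (n + 1) := by
      obtain ⟨c, hc⟩ := Nat.exists_eq_add_of_le' (ha z (by omega) le_rfl)
      rw [hrep, hc, wpow_succ_right, ← List.append_assoc]
      exact List.suffix_append _ _
    obtain ⟨q, hq⟩ : B ++ List.replicate (e + 1) true ++ (B ++ List.replicate (e + 1) true) <+:
        Bseq r s (n + 1) := by
      rw [hrep]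
      refine List.IsPrefix.trans ?_ ((flatten_map_range_prefix f
        (show 2 ≤ z - 1 by omega)).trans (List.prefix_append _ _))
      simp [List.range_succ, hf1 0 h1, hf1 1 h2]
    refine ⟨p, List.replicate e true ++ q, ?_⟩
    calc _ = (p ++ B) ++ List.replicate (e + 1) true ++
          (B ++ List.replicate (e + 1) true ++ (B ++ List.replicate (e + 1) true) ++ q) := by
          simp only [List.append_assoc, List.replicate_succ, List.cons_append, List.nil_append]
      _ = _ := by rw [hp, hq]
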